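/- Let F = (F_1, …, F_m) : ℝⁿ → ℝᵐ have each component F_i locally Lipschitz on ℝⁿ and quasiconvex, and let {x^k} be an SPPM sequence such that for every k the interior of Ω_{k+1} = {x : F(x) ⪯ F(x^{k+1})} is nonempty with F(x) ≺ F(x^{k+1}) for every x in that interior. Assume (H3): there exists a ∈ ℝⁿ with F(a) ⪯ F(x^k) for all k, so that E = {x ∈ ℝⁿ : F(x) ⪯ F(x^k) for all k} is nonempty. Then for every x* ∈ E and every k ∈ ℕ: ‖x^{k+1} − x^k‖² ≤ ‖x^k − x*‖² − ‖x^{k+1} − x*‖²; in particular ‖x^{k+1} − x*‖ ≤ ‖x^k − x*‖, i.e. {x^k} is Fejér convergent to E. -/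

import Mathlib

open Filter Metric Set
open scoped Topology RealInnerProductSpace Pointwise

/-- The Clarke directional derivative of `f` at `x` in the direction `d`. -/
noncomputable def clarkeDeriv {n : ℕ} (f : EuclideanSpace ℝ (Fin n) → ℝ)
    (x d : EuclideanSpace ℝ (Fin n)) : ℝ :=
  Filter.limsup (fun p : EuclideanSpace ℝ (Fin n) × ℝ => (f (p.1 + p.2 • d) - f p.1) / p.2)
    ((𝓝 x) ×ˢ (𝓝[>] (0 : ℝ)))

/-- The Clarke subdifferential of `f` at `x`. -/
def clarkeSubdiff {n : ℕ} (f : EuclideanSpace ℝ (Fin n) → ℝ) (x : EuclideanSpace ℝ (Fin n)) :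
    Set (EuclideanSpace ℝ (Fin n)) :=
  {w | ∀ d, ⟪w, d⟫ ≤ clarkeDeriv f x d}

/-- The normal cone to `D` at `x`. -/
def normalCone {n : ℕ} (D : Set (EuclideanSpace ℝ (Fin n))) (x : EuclideanSpace ℝ (Fin n)) :
    Set (EuclideanSpace ℝ (Fin n)) :=
  {v | ∀ y ∈ D, ⟪v, y - x⟫ ≤ 0}

/-- `f` is locally Lipschitz on `ℝⁿ`. -/
def LocLipOn {n : ℕ} (f : EuclideanSpace ℝ (Fin n) → ℝ) : Prop :=
  ∀ x, ∃ ε > (0 : ℝ), ∃ L > (0 : ℝ),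
    ∀ z ∈ ball x ε, ∀ y ∈ ball x ε, |f z - f y| ≤ L * ‖z - y‖

/-- `f` is quasiconvex. -/
def QuasiconvexFun {n : ℕ} (f : EuclideanSpace ℝ (Fin n) → ℝ) : Prop :=
  ∀ x y, ∀ t ∈ Set.Icc (0 : ℝ) 1, f (t • x + (1 - t) • y) ≤ max (f x) (f y)

/-- An SPPM sequence for `F` with parameters `α`, `e`, `z`: for every `k`,
`x^{k+1} ∈ Ω_k = {x : F(x) ⪯ F(x^k)}` and `0 ∈ ∂°h_k(x^{k+1}) + N_{Ω_k}(x^{k+1})`,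
where `h_k(x) = ⟨F(x), z_k⟩ + (α_k/2)⟨e_k, z_k⟩‖x − x^k‖²`. -/
def SPPMSeq {n m : ℕ} (F : Fin m → EuclideanSpace ℝ (Fin n) → ℝ)
    (x : ℕ → EuclideanSpace ℝ (Fin n)) (α : ℕ → ℝ)
    (e z : ℕ → EuclideanSpace ℝ (Fin m)) : Prop :=
  (∀ k, 0 < α k) ∧ (∀ k i, 0 < e k i) ∧ (∀ k i, 0 ≤ z k i) ∧ (∀ k, z k ≠ 0) ∧
  (∀ k, (∀ i, F i (x (k + 1)) ≤ F i (x k)) ∧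
    (0 : EuclideanSpace ℝ (Fin n)) ∈
      clarkeSubdiff
        (fun y => (∑ i, z k i * F i y) + α k / 2 * (∑ i, e k i * z k i) * ‖y - x k‖ ^ 2)
        (x (k + 1)) +
      normalCone {y : EuclideanSpace ℝ (Fin n) | ∀ i, F i y ≤ F i (x k)} (x (k + 1)))


/-- The filter along which the Clarke directional derivative takes its limit superior. -/
def clarkeFilter {n : ℕ} (x : EuclideanSpace ℝ (Fin n)) :
    Filter (EuclideanSpace ℝ (Fin n) × ℝ) :=
  (𝓝 x) ×ˢ (𝓝[>] (0 : ℝ))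

instance {n : ℕ} (x : EuclideanSpace ℝ (Fin n)) : (clarkeFilter x).NeBot := by
  unfold clarkeFilter
  infer_instance

theorem tendsto_fst_clarkeFilter {n : ℕ} (x : EuclideanSpace ℝ (Fin n)) :
    Tendsto Prod.fst (clarkeFilter x) (𝓝 x) :=
  tendsto_fst

theorem tendsto_snd_clarkeFilter {n : ℕ} (x : EuclideanSpace ℝ (Fin n)) :
    Tendsto Prod.snd (clarkeFilter x) (𝓝 (0 : ℝ)) :=
  tendsto_nhds_of_tendsto_nhdsWithin tendsto_snd

theorem eventually_snd_pos_clarkeFilter {n : ℕ} (x : EuclideanSpace ℝ (Fin n)) :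
    ∀ᶠ p in clarkeFilter x, 0 < p.2 :=
  (tendsto_snd : Tendsto Prod.snd (clarkeFilter x) (𝓝[>] (0 : ℝ))).eventually
    self_mem_nhdsWithin

theorem tendsto_add_smul_clarkeFilter {n : ℕ} (x d : EuclideanSpace ℝ (Fin n)) :
    Tendsto (fun p : EuclideanSpace ℝ (Fin n) × ℝ => p.1 + p.2 • d) (clarkeFilter x) (𝓝 x) := by
  simpa using (tendsto_fst_clarkeFilter x).add ((tendsto_snd_clarkeFilter x).smul_const d)

theorem LocLipOn.continuous {n : ℕ} {f : EuclideanSpace ℝ (Fin n) → ℝ} (hf : LocLipOn f) :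
    Continuous f := by
  refine continuous_iff_continuousAt.2 fun x => ?_
  obtain ⟨ε, hε, L, -, h⟩ := hf x
  rw [ContinuousAt, tendsto_iff_dist_tendsto_zero]
  have hlim : Tendsto (fun y => L * ‖y - x‖) (𝓝 x) (𝓝 0) := by
    have hc : Continuous fun y : EuclideanSpace ℝ (Fin n) => L * ‖y - x‖ := by fun_prop
    simpa using hc.tendsto x
  refine squeeze_zero' (Eventually.of_forall fun _ => dist_nonneg) ?_ hlim
  filter_upwards [ball_mem_nhds x hε] with y hy
  simpa [Real.dist_eq] using h y hy x (mem_ball_self hε)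

/-- The difference quotients of a locally Lipschitz function are locally bounded below. -/
theorem LocLipOn.exists_le_quotient {n : ℕ} {f : EuclideanSpace ℝ (Fin n) → ℝ} (hf : LocLipOn f)
    (x d : EuclideanSpace ℝ (Fin n)) :
    ∃ C : ℝ, ∀ᶠ p in clarkeFilter x, C ≤ (f (p.1 + p.2 • d) - f p.1) / p.2 := by
  obtain ⟨ε, hε, L, -, h⟩ := hf x
  refine ⟨-(L * ‖d‖), ?_⟩
  filter_upwards [eventually_snd_pos_clarkeFilter x,
    (tendsto_fst_clarkeFilter x).eventually (ball_mem_nhds x hε),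
    (tendsto_add_smul_clarkeFilter x d).eventually (ball_mem_nhds x hε)] with p hp h₁ h₂
  have hb := (abs_le.1 (h _ h₂ _ h₁)).1
  rw [add_sub_cancel_left, norm_smul, Real.norm_of_nonneg hp.le] at hb
  rw [le_div_iff₀ hp]
  linarith

/-- Near `x`, a quasiconvex continuous function does not increase in the direction of a point
where it is smaller. -/
theorem QuasiconvexFun.eventually_le {n : ℕ} {f : EuclideanSpace ℝ (Fin n) → ℝ}
    (hq : QuasiconvexFun f) (hc : Continuous f) {x y : EuclideanSpace ℝ (Fin n)}
    (hxy : f y < f x) :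
    ∀ᶠ p in clarkeFilter x, f (p.1 + p.2 • (y - x)) ≤ f p.1 := by
  have h₁ : Tendsto (fun p : EuclideanSpace ℝ (Fin n) × ℝ => f (p.1 + (y - x)))
      (clarkeFilter x) (𝓝 (f y)) := by
    have := (hc.tendsto _).comp ((tendsto_fst_clarkeFilter x).add_const (y - x))
    simpa [Function.comp_def] using this
  have h₂ : Tendsto (fun p : EuclideanSpace ℝ (Fin n) × ℝ => f p.1)
      (clarkeFilter x) (𝓝 (f x)) :=
    (hc.tendsto _).comp (tendsto_fst_clarkeFilter x)
  filter_upwards [h₁.eventually_lt h₂ hxy, eventually_snd_pos_clarkeFilter x,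
    (tendsto_snd_clarkeFilter x).eventually (gt_mem_nhds one_pos)] with p hlt hp hp1
  have h := hq (p.1 + (y - x)) p.1 p.2 ⟨hp.le, hp1.le⟩
  rw [max_eq_right hlt.le] at h
  convert h using 2
  module

theorem QuasiconvexFun.convex_sublevel {n : ℕ} {f : EuclideanSpace ℝ (Fin n) → ℝ}
    (hq : QuasiconvexFun f) (r : ℝ) : Convex ℝ {y | f y ≤ r} := by
  intro a ha b hb s t hs ht hst
  have h := hq a b s ⟨hs, by linarith⟩
  rw [show 1 - s = t by linarith] at h
  exact h.trans (max_le ha hb)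

theorem tendsto_quotient_norm_sub_sq {n : ℕ} (x c d : EuclideanSpace ℝ (Fin n)) (a : ℝ) :
    Tendsto (fun p : EuclideanSpace ℝ (Fin n) × ℝ =>
      (a / 2 * ‖p.1 + p.2 • d - c‖ ^ 2 - a / 2 * ‖p.1 - c‖ ^ 2) / p.2)
      (clarkeFilter x) (𝓝 (a * ⟪x - c, d⟫)) := by
  have hlim : Tendsto (fun p : EuclideanSpace ℝ (Fin n) × ℝ =>
      a * ⟪p.1 - c, d⟫ + a / 2 * (p.2 * ‖d‖ ^ 2)) (clarkeFilter x) (𝓝 (a * ⟪x - c, d⟫)) := by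
    have h₁ := (((tendsto_fst_clarkeFilter x).sub_const c).inner
      (tendsto_const_nhds (x := d))).const_mul a
    have h₂ := ((tendsto_snd_clarkeFilter x).mul_const (‖d‖ ^ 2)).const_mul (a / 2)
    simpa using h₁.add h₂
  refine hlim.congr' ?_
  filter_upwards [eventually_snd_pos_clarkeFilter x] with p hp
  have hs : p.1 + p.2 • d - c = (p.1 - c) + p.2 • d := by abel
  rw [eq_div_iff hp.ne', hs, norm_add_sq_real, real_inner_smul_right, norm_smul,
    Real.norm_of_nonneg hp.le]
  ring

/-- The Clarke derivative of a proximally regularized scalarization, in the direction of a point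
at which every component is strictly smaller, is at most the derivative of the quadratic term. -/
theorem clarkeDeriv_scalarization_le {n m : ℕ} {F : Fin m → EuclideanSpace ℝ (Fin n) → ℝ}
    (hlip : ∀ i, LocLipOn (F i)) (hquasi : ∀ i, QuasiconvexFun (F i)) {z : Fin m → ℝ}
    (hz : ∀ i, 0 ≤ z i) (a : ℝ) (c : EuclideanSpace ℝ (Fin n)) {x y : EuclideanSpace ℝ (Fin n)}
    (hxy : ∀ i, F i y < F i x) :
    clarkeDeriv (fun u => (∑ i, z i * F i u) + a / 2 * ‖u - c‖ ^ 2) x (y - x) ≤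
      a * ⟪x - c, y - x⟫ := by
  have hlim := tendsto_quotient_norm_sub_sq x c (y - x) a
  choose C hC using fun i => (hlip i).exists_le_quotient x (y - x)
  have hsplit : ∀ p : EuclideanSpace ℝ (Fin n) × ℝ,
      (((∑ i, z i * F i (p.1 + p.2 • (y - x))) + a / 2 * ‖p.1 + p.2 • (y - x) - c‖ ^ 2) -
        ((∑ i, z i * F i p.1) + a / 2 * ‖p.1 - c‖ ^ 2)) / p.2 =
      (∑ i, z i * ((F i (p.1 + p.2 • (y - x)) - F i p.1) / p.2)) +
        (a / 2 * ‖p.1 + p.2 • (y - x) - c‖ ^ 2 - a / 2 * ‖p.1 - c‖ ^ 2) / p.2 := by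
    intro p
    have hsum : ∑ i, z i * ((F i (p.1 + p.2 • (y - x)) - F i p.1) / p.2) =
        ((∑ i, z i * F i (p.1 + p.2 • (y - x))) - ∑ i, z i * F i p.1) / p.2 := by
      rw [← Finset.sum_sub_distrib, Finset.sum_div]
      exact Finset.sum_congr rfl fun i _ => by ring
    rw [hsum]
    ring
  rw [clarkeDeriv]
  simp only [hsplit]
  rw [← hlim.limsup_eq]
  refine limsup_le_limsup ?_ ?_ hlim.isBoundedUnder_le
  · filter_upwards [eventually_snd_pos_clarkeFilter x, eventually_all.2 fun i =>
      (hquasi i).eventually_le (hlip i).continuous (hxy i)] with p hp hle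
    have : ∑ i, z i * ((F i (p.1 + p.2 • (y - x)) - F i p.1) / p.2) ≤ 0 :=
      Finset.sum_nonpos fun i _ => mul_nonpos_of_nonneg_of_nonpos (hz i)
        (div_nonpos_of_nonpos_of_nonneg (sub_nonpos.2 (hle i)) hp.le)
    linarith
  · refine IsBoundedUnder.isCoboundedUnder_le (l := clarkeFilter x)
      ⟨(∑ i, z i * C i) + (a * ⟪x - c, y - x⟫ - 1), ?_⟩
    rw [eventually_map]
    filter_upwards [eventually_all.2 hC, hlim.eventually (lt_mem_nhds (sub_one_lt _))]
      with p hCp hqp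
    exact add_le_add (Finset.sum_le_sum fun i _ => mul_le_mul_of_nonneg_left (hCp i) (hz i)) hqp.le

/-- Fejér convergence of the SPPM sequence to `E = {x : F(x) ⪯ F(x^k) ∀ k}`. -/
theorem sppm_fejer {n m : ℕ} (F : Fin m → EuclideanSpace ℝ (Fin n) → ℝ)
    (hlip : ∀ i, LocLipOn (F i)) (hquasi : ∀ i, QuasiconvexFun (F i))
    (x : ℕ → EuclideanSpace ℝ (Fin n)) (α : ℕ → ℝ) (e z : ℕ → EuclideanSpace ℝ (Fin m))
    (hsppm : SPPMSeq F x α e z)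
    (hint : ∀ k,
      (interior {y : EuclideanSpace ℝ (Fin n) | ∀ i, F i y ≤ F i (x (k + 1))}).Nonempty ∧
      ∀ y ∈ interior {y : EuclideanSpace ℝ (Fin n) | ∀ i, F i y ≤ F i (x (k + 1))},
        ∀ i, F i y < F i (x (k + 1)))
    (hH3 : ∃ a : EuclideanSpace ℝ (Fin n), ∀ k, ∀ i, F i a ≤ F i (x k)) :
    ∀ xstar ∈ {y : EuclideanSpace ℝ (Fin n) | ∀ k, ∀ i, F i y ≤ F i (x k)}, ∀ k : ℕ,
      ‖x (k + 1) - x k‖ ^ 2 ≤ ‖x k - xstar‖ ^ 2 - ‖x (k + 1) - xstar‖ ^ 2 ∧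
      ‖x (k + 1) - xstar‖ ≤ ‖x k - xstar‖ := by
  obtain ⟨hα, he, hz, hz0, hstep⟩ := hsppm
  intro xstar hxstar k
  obtain ⟨hdesc, w, hw, v, hv, hwv⟩ := hstep k
  obtain ⟨hne, hlt⟩ := hint k
  have hβ : 0 < ∑ i, e k i * z k i := by
    obtain ⟨i, hi⟩ : ∃ i, z k i ≠ 0 := by
      by_contra! h
      exact hz0 k (PiLp.ext h)
    exact Finset.sum_pos' (fun j _ => mul_nonneg (he k j).le (hz k j))
      ⟨i, Finset.mem_univ i, mul_pos (he k i) ((hz k i).lt_of_ne' hi)⟩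
  have hinterior : interior {y : EuclideanSpace ℝ (Fin n) | ∀ i, F i y ≤ F i (x (k + 1))} ⊆
      {y | 0 ≤ ⟪x (k + 1) - x k, y - x (k + 1)⟫} := by
    intro y hy
    have hwy : 0 ≤ ⟪w, y - x (k + 1)⟫ := by
      have h := hv y fun i => (hlt y hy i).le.trans (hdesc i)
      rw [eq_neg_of_add_eq_zero_left hwv, inner_neg_left]
      linarith
    have hle := clarkeDeriv_scalarization_le hlip hquasi (hz k)
      (α k * ∑ i, e k i * z k i) (x k) (hlt y hy)
    rw [mul_div_right_comm] at hle
    exact nonneg_of_mul_nonneg_right (hwy.trans ((hw _).trans hle)) (mul_pos (hα k) hβ)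
  have hconv : Convex ℝ {y : EuclideanSpace ℝ (Fin n) | ∀ i, F i y ≤ F i (x (k + 1))} := by
    rw [ofPred_forall]
    exact convex_iInter fun i => (hquasi i).convex_sublevel _
  have hclosed : IsClosed {y | 0 ≤ ⟪x (k + 1) - x k, y - x (k + 1)⟫} :=
    isClosed_le continuous_const (by fun_prop)
  have hinner : 0 ≤ ⟪x (k + 1) - x k, xstar - x (k + 1)⟫ := by
    refine closure_minimal hinterior hclosed ?_
    rw [hconv.closure_interior_eq_closure_of_nonempty_interior hne]
    exact subset_closure (hxstar (k + 1))
  have hnorm := norm_add_sq_real (x (k + 1) - x k) (xstar - x (k + 1))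
  rw [show x (k + 1) - x k + (xstar - x (k + 1)) = xstar - x k by abel,
    norm_sub_rev xstar, norm_sub_rev xstar] at hnorm
  have hmain : ‖x (k + 1) - x k‖ ^ 2 ≤ ‖x k - xstar‖ ^ 2 - ‖x (k + 1) - xstar‖ ^ 2 := by
    linarith
  refine ⟨hmain, (sq_le_sq₀ (norm_nonneg _) (norm_nonneg _)).1 ?_⟩
  linarith [sq_nonneg ‖x (k + 1) - x k‖]
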